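/- Let K be a field of characteristic zero containing a primitive n-th root of unity ζ (n ≥ 2), r an integer such that ζ^r is again a primitive n-th root of unity, and x ∈ K. Then the centre Z(𝒥_x(r)) of the Jackson algebra 𝒥_x(r) over K is a Cohen–Macaulay ring (its localization at every maximal ideal is a Cohen–Macaulay local ring), and the same holds for the centre of the base change 𝒥_x(r) ⊗_K K^alg to an algebraic closure of K. -/

import Mathlib

open scoped TensorProduct

/-- The defining relations of the Jackson algebra `𝒥_x(r)` over `K`:
generators `e₀, e₁, e₂` and relations `e₀e₁ = ζ^r e₁e₀`, `e₂e₀ = ζ^r e₀e₂`,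
`e₂e₁ = ζ^{2r} e₁e₂ + x e₀ + x (1 − ζ^{2r})`. -/
inductive JacksonRel (K : Type*) [Field K] (ζ : K) (r : ℤ) (x : K) :
    FreeAlgebra K (Fin 3) → FreeAlgebra K (Fin 3) → Prop
  | r01 : JacksonRel K ζ r x (FreeAlgebra.ι K 0 * FreeAlgebra.ι K 1)
      (ζ ^ r • (FreeAlgebra.ι K 1 * FreeAlgebra.ι K 0))
  | r20 : JacksonRel K ζ r x (FreeAlgebra.ι K 2 * FreeAlgebra.ι K 0)
      (ζ ^ r • (FreeAlgebra.ι K 0 * FreeAlgebra.ι K 2))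
  | r21 : JacksonRel K ζ r x (FreeAlgebra.ι K 2 * FreeAlgebra.ι K 1)
      (ζ ^ (2 * r) • (FreeAlgebra.ι K 1 * FreeAlgebra.ι K 2) + x • FreeAlgebra.ι K 0 +
        (x * (1 - ζ ^ (2 * r))) • (1 : FreeAlgebra K (Fin 3)))

/-- The Jackson algebra `𝒥_x(r)` over `K`. -/
abbrev Jackson (K : Type*) [Field K] (ζ : K) (r : ℤ) (x : K) :=
  RingQuot (JacksonRel K ζ r x)

/-- A (local) commutative ring is *Cohen–Macaulay* if it admits a regular sequence of
non-units whose length equals its Krull dimension (for a Noetherian local ring this is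
the usual condition `depth = dim`). -/
def IsCohenMacaulayLocal (R : Type*) [CommRing R] : Prop :=
  ∃ rs : List R, (∀ a ∈ rs, ¬IsUnit a) ∧ RingTheory.Sequence.IsRegular R rs ∧
    (rs.length : WithBot ℕ∞) = ringKrullDim R


section CommAlg
open Polynomial RingTheory.Sequence

lemma jk_weaklyRegular_poly {R : Type*} [CommRing R] {rs : List R} (h : IsWeaklyRegular R rs)
    (f : R[X]) (hf : f.Monic) : IsWeaklyRegular R[X] (rs.map (C : R →+* R[X]) ++ [f]) := by
  rw [isWeaklyRegular_append_iff, isWeaklyRegular_singleton_iff]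
  refine ⟨h.of_flat (S := R[X]), ?_⟩
  have key : ∀ p : R[X], f * p ∈ Ideal.map (C : R →+* R[X]) (Ideal.ofList rs) →
      p ∈ Ideal.map (C : R →+* R[X]) (Ideal.ofList rs) := by
    intro p hp
    have hk : ∀ q : R[X], q ∈ Ideal.map (C : R →+* R[X]) (Ideal.ofList rs) ↔
        q.map (Ideal.Quotient.mk (Ideal.ofList rs)) = 0 := by
      intro q
      rw [← Polynomial.coe_mapRingHom, ← RingHom.mem_ker, Polynomial.ker_mapRingHom,
        Ideal.mk_ker]
    rw [hk] at hp ⊢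
    rw [Polynomial.map_mul] at hp
    exact (hf.map _).mul_right_eq_zero_iff.mp hp
  rw [isSMulRegular_iff_right_eq_zero_of_smul]
  intro y hy
  obtain ⟨p, rfl⟩ := Submodule.Quotient.mk_surjective _ y
  rw [← Submodule.Quotient.mk_smul, Submodule.Quotient.mk_eq_zero] at hy
  rw [Submodule.Quotient.mk_eq_zero]
  have e : (Ideal.ofList (rs.map (C : R →+* R[X])) • ⊤ : Submodule R[X] R[X]) =
      Ideal.map (C : R →+* R[X]) (Ideal.ofList rs) := by
    rw [Ideal.map_ofList]; simp
  rw [e] at hy ⊢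
  exact key p hy

lemma jk_dim_le_of_integral {P Z : Type*} [CommRing P] [CommRing Z] [Algebra P Z]
    [Algebra.IsIntegral P Z] : ringKrullDim Z ≤ ringKrullDim P := by
  refine Order.krullDim_le_of_strictMono (fun p => PrimeSpectrum.comap (algebraMap P Z) p) ?_
  intro a b hab
  have hab' : a.asIdeal < b.asIdeal := hab
  exact Ideal.IsIntegral.comap_lt_comap (R := P) hab'

lemma jk_step {K : Type*} [Field K] {n : ℕ} {rs : List (MvPolynomial (Fin n) K)}
    (h : IsWeaklyRegular (MvPolynomial (Fin n) K) rs) (f : K[X]) (hf : f.Monic) :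
    IsWeaklyRegular (MvPolynomial (Fin (n + 1)) K)
      (rs.map (MvPolynomial.rename Fin.succ) ++ [aeval (MvPolynomial.X 0) f]) := by
  have h1 := jk_weaklyRegular_poly h (f.map MvPolynomial.C) (hf.map _)
  refine (AddEquiv.isWeaklyRegular_congr
    (e := (MvPolynomial.finSuccEquiv K n).toAddEquiv) ?_).mpr h1
  have hl : rs.map (C : _ →+* (MvPolynomial (Fin n) K)[X]) ++ [f.map MvPolynomial.C] =
      (rs.map (MvPolynomial.rename Fin.succ) ++ [aeval (MvPolynomial.X 0) f]).map
        (MvPolynomial.finSuccEquiv K n) := by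
    simp only [List.map_append, List.map_map, List.map_cons, List.map_nil]
    congr 1
    · apply List.map_congr_left
      intro a _
      have : ((MvPolynomial.finSuccEquiv K n).toAlgHom.comp (MvPolynomial.rename Fin.succ)) =
          (IsScalarTower.toAlgHom K (MvPolynomial (Fin n) K) (MvPolynomial (Fin n) K)[X]) := by
        apply MvPolynomial.algHom_ext
        intro i
        simp [MvPolynomial.finSuccEquiv_X_succ]
      exact (DFunLike.congr_fun this a).symm
    · congr 1
      rw [← aeval_algHom_apply (MvPolynomial.finSuccEquiv K n) _ f, MvPolynomial.finSuccEquiv_X_zero]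
      rw [aeval_def]
      rfl
  rw [hl]
  refine List.forall₂_map_right_iff.mpr <|
    List.forall₂_same.mpr fun r _ x => ?_
  exact map_mul (MvPolynomial.finSuccEquiv K n) r x

lemma jk_weaklyRegular_three {K : Type*} [Field K] (f0 f1 f2 : K[X]) (h0 : f0.Monic)
    (h1 : f1.Monic) (h2 : f2.Monic) : IsWeaklyRegular (MvPolynomial (Fin 3) K)
      [aeval (MvPolynomial.X 2 : MvPolynomial (Fin 3) K) f2,
        aeval (MvPolynomial.X 1 : MvPolynomial (Fin 3) K) f1,
        aeval (MvPolynomial.X 0 : MvPolynomial (Fin 3) K) f0] := by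
  have w0 : IsWeaklyRegular (MvPolynomial (Fin 0) K) ([] : List (MvPolynomial (Fin 0) K)) :=
    IsWeaklyRegular.nil _ _
  have w1 := jk_step w0 f2 h2
  have w2 := jk_step w1 f1 h1
  have := jk_step w2 f0 h0
  have e : ∀ (n : ℕ) (i : Fin n) (f : K[X]), MvPolynomial.rename (R := K) Fin.succ
      (aeval (MvPolynomial.X i) f) = aeval (MvPolynomial.X i.succ) f := by
    intro n i f
    rw [← aeval_algHom_apply (MvPolynomial.rename (R := K) (Fin.succ (n := n))),
      MvPolynomial.rename_X]
  simpa [e] using this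

theorem jk_CM {K Z P : Type*} [Field K] [CommRing P] [CommRing Z] [Algebra K Z] [Algebra K P]
    [Algebra P Z] [IsScalarTower K P Z] [IsNoetherianRing P] [Algebra.FiniteType K P]
    (hdP : ringKrullDim P = 3) [Module.Finite P Z] [Module.Flat P Z]
    (X0 X1 X2 : P) (hP : ∀ f0 f1 f2 : K[X], f0.Monic → f1.Monic → f2.Monic →
      IsWeaklyRegular P [aeval X2 f2, aeval X1 f1, aeval X0 f0])
    (m : Ideal Z) [hm : m.IsMaximal] (Rm : Type*) [CommRing Rm] [Algebra Z Rm]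
    [IsLocalization.AtPrime Rm m] : IsCohenMacaulayLocal Rm := by
  have : Algebra.IsIntegral P Z := Algebra.IsIntegral.of_finite _ _
  have hft : Algebra.FiniteType K Z := Algebra.FiniteType.trans (S := P) inferInstance inferInstance
  have hZn : IsNoetherianRing Z := IsNoetherianRing.of_finite P Z
  have hRn : IsNoetherianRing Rm := IsLocalization.isNoetherianRing m.primeCompl Rm hZn
  have hloc : IsLocalRing Rm := IsLocalization.AtPrime.isLocalRing Rm m
  let _ := Ideal.Quotient.field m
  have hfin : Module.Finite K (Z ⧸ m) := finite_of_finite_type_of_isJacobsonRing K (Z ⧸ m)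
  have hex : ∀ z : P, ∃ f : K[X], f.Monic ∧ algebraMap P Z (aeval z f) ∈ m := by
    intro z
    obtain ⟨f, hf, hz⟩ := IsIntegral.of_finite K (Ideal.Quotient.mk m (algebraMap P Z z))
    refine ⟨f, hf, ?_⟩
    rw [← aeval_algebraMap_apply, ← Ideal.Quotient.eq_zero_iff_mem]
    rw [← aeval_def] at hz
    rw [← hz]
    exact (aeval_algHom_apply (Ideal.Quotient.mkₐ K m) _ f).symm
  obtain ⟨f0, hf0, h0⟩ := hex X0
  obtain ⟨f1, hf1, h1⟩ := hex X1
  obtain ⟨f2, hf2, h2⟩ := hex X2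
  have w3 := (hP f0 f1 f2 hf0 hf1 hf2).of_flat (S := Z)
  have hmem : ∀ z ∈ List.map (algebraMap P Z) [aeval X2 f2, aeval X1 f1, aeval X0 f0], z ∈ m := by
    intro a ha
    simp only [List.map_cons, List.map_nil, List.mem_cons, List.not_mem_nil, or_false] at ha
    rcases ha with rfl | rfl | rfl <;> assumption
  have hreg := w3.isRegular_of_isLocalization_of_mem Rm m hmem
  refine ⟨_, ?_, hreg, ?_⟩
  · intro a ha hu
    obtain ⟨z, hz, rfl⟩ := List.mem_map.mp ha
    rw [IsLocalization.AtPrime.isUnit_to_map_iff Rm m] at hu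
    exact hu (hmem z hz)
  · have hlen := ringKrullDim_add_length_eq_ringKrullDim_of_isRegular _ hreg
    have hub : ringKrullDim Rm ≤ 3 := by
      rw [IsLocalization.AtPrime.ringKrullDim_eq_height m Rm, ← hdP]
      exact (Ideal.height_le_ringKrullDim_of_ne_top hm.ne_top).trans jk_dim_le_of_integral
    have hnt := hreg.quot_ofList_smul_nontrivial ⊤
    simp only [smul_eq_mul, Ideal.mul_top] at hnt
    apply le_antisymm
    · rw [← hlen]
      exact le_add_of_nonneg_left ringKrullDim_nonneg_of_nontrivial
    · simpa using hub

end CommAlg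

section JKAlg

/-- The Jackson relations in an arbitrary algebra. -/
structure JKRel {K A : Type*} [Field K] [Ring A] [Algebra K A] (q x : K) (e0 e1 e2 : A) : Prop where
  h01 : e0 * e1 = q • (e1 * e0)
  h20 : e2 * e0 = q • (e0 * e2)
  h21 : e2 * e1 = q ^ 2 • (e1 * e2) + x • e0 + (x * (1 - q ^ 2)) • (1 : A)

variable {K A : Type*} [Field K] [Ring A] [Algebra K A] {q x : K} {e0 e1 e2 : A}

lemma JKRel.op (h : JKRel q x e0 e1 e2) :
    JKRel q x (MulOpposite.op e0) (MulOpposite.op e2) (MulOpposite.op e1) where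
  h01 := by
    rw [← MulOpposite.op_mul, ← MulOpposite.op_mul, h.h20]; rfl
  h20 := by
    rw [← MulOpposite.op_mul, ← MulOpposite.op_mul, h.h01]; rfl
  h21 := by
    rw [← MulOpposite.op_mul, ← MulOpposite.op_mul, h.h21]; rfl

/-- If `a b = c b a` then `a b^j = c^j b^j a`. -/
lemma jk_qcomm_pow {a b : A} {c : K} (h : a * b = c • (b * a)) (j : ℕ) :
    a * b ^ j = c ^ j • (b ^ j * a) := by
  induction j with
  | zero => simp
  | succ j ih =>
    rw [pow_succ, ← mul_assoc, ih, smul_mul_assoc, mul_assoc, h, mul_smul_comm, smul_smul,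
      ← mul_assoc, ← pow_succ, ← pow_succ]

lemma jk_qcomm_pow_left {a b : A} {c : K} (h : a * b = c • (b * a)) (j : ℕ) :
    a ^ j * b = c ^ j • (b * a ^ j) := by
  induction j with
  | zero => simp
  | succ j ih =>
    rw [pow_succ', mul_assoc, ih, mul_smul_comm, ← mul_assoc, h, smul_mul_assoc, smul_smul,
      mul_assoc, ← pow_succ', ← pow_succ]

lemma jk_qcomm_symm {a b : A} {c : K} (hc : c ≠ 0) (h : a * b = c • (b * a)) :
    b * a = c⁻¹ • (a * b) := by
  rw [h, smul_smul, inv_mul_cancel₀ hc, one_smul]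

lemma JKRel.e2_e1_pow (h : JKRel q x e0 e1 e2) (hq : q ≠ 0) (j : ℕ) :
    e2 * e1 ^ (j + 1) = q ^ (2 * (j + 1)) • (e1 ^ (j + 1) * e2)
      + (x * ∑ l ∈ Finset.range (j + 1), q ^ l) • (e0 * e1 ^ j)
      + (x * (1 - q ^ (2 * (j + 1)))) • e1 ^ j := by
  induction j with
  | zero => simp [h.h21]
  | succ j ih =>
    obtain ⟨p, h1, hp⟩ : ∃ p : K, e1 ^ (j + 1) * e0 = p • (e0 * e1 ^ (j + 1)) ∧
        q ^ (2 * (j + 1)) * p = q ^ (j + 1) := by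
      refine ⟨(q⁻¹) ^ (j + 1), jk_qcomm_pow_left (jk_qcomm_symm hq h.h01) (j + 1), ?_⟩
      rw [two_mul, pow_add, inv_pow]; field_simp
    rw [pow_succ e1 (j + 1), ← mul_assoc, ih]
    simp only [add_mul, smul_mul_assoc, mul_assoc, h.h21, mul_add, mul_smul_comm, h1, mul_one,
      ← pow_succ]
    rw [Finset.sum_range_succ _ (j + 1)]
    simp only [smul_add, smul_smul]
    rw [← mul_assoc (e1 ^ (j + 1)) e1 e2, ← pow_succ]
    have h2 : q ^ (2 * j + 2) * (x * p) = x * q ^ (j + 1) := by rw [← hp]; ring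
    rw [h2]
    module

lemma JKRel.pow_central (h : JKRel q x e0 e1 e2) {n : ℕ} (hn : 2 ≤ n) (hq : IsPrimitiveRoot q n) :
    Commute e0 (e1 ^ n) ∧ Commute e2 (e1 ^ n) ∧ Commute e1 (e0 ^ n) ∧ Commute e2 (e0 ^ n) := by
  have hq0 : q ≠ 0 := hq.ne_zero (by omega)
  have hqn : q ^ n = 1 := hq.pow_eq_one
  refine ⟨?_, ?_, ?_, ?_⟩
  · have := jk_qcomm_pow h.h01 n
    rw [hqn, one_smul] at this
    exact this
  · obtain ⟨j, rfl⟩ : ∃ j, n = j + 1 := ⟨n - 1, by omega⟩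
    have := h.e2_e1_pow hq0 j
    rw [hq.geom_sum_eq_zero (by omega), mul_comm 2, pow_mul, hqn] at this
    rw [one_pow, sub_self, mul_zero, zero_smul, zero_smul, one_smul, add_zero, add_zero] at this
    exact this
  · have := jk_qcomm_pow (jk_qcomm_symm hq0 h.h01) n
    rw [inv_pow, hqn, inv_one, one_smul] at this
    exact this
  · have := jk_qcomm_pow h.h20 n
    rw [hqn, one_smul] at this
    exact this

lemma JKRel.pow_central' (h : JKRel q x e0 e1 e2) {n : ℕ} (hn : 2 ≤ n) (hq : IsPrimitiveRoot q n) :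
    Commute e0 (e2 ^ n) ∧ Commute e1 (e2 ^ n) := by
  obtain ⟨h1, h2, -, -⟩ := h.op.pow_central hn hq
  rw [← MulOpposite.op_pow] at h1 h2
  exact ⟨(MulOpposite.op_injective h1).symm, (MulOpposite.op_injective h2).symm⟩

/-- Normal (Casimir) element. -/
def jkOmega (q x : K) (e0 e1 e2 : A) : A := e1 * e2 + (x / (q ^ 2 - q)) • e0 - x • (1 : A)

lemma JKRel.omega_e0 (h : JKRel q x e0 e1 e2) : Commute e0 (jkOmega q x e0 e1 e2) := by
  have h1 : Commute e0 (e1 * e2) := by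
    change e0 * (e1 * e2) = (e1 * e2) * e0
    rw [← mul_assoc, h.h01, mul_assoc e1 e2, h.h20, smul_mul_assoc, mul_smul_comm, mul_assoc]
  unfold jkOmega
  exact (h1.add_right ((Commute.refl e0).smul_right _)).sub_right ((Commute.one_right e0).smul_right _)

lemma JKRel.omega_e1 (h : JKRel q x e0 e1 e2) (hq0 : q ≠ 0) (hq1 : q ≠ 1) :
    jkOmega q x e0 e1 e2 * e1 = q ^ 2 • (e1 * jkOmega q x e0 e1 e2) := by
  have hd : q ^ 2 - q ≠ 0 := by
    have : q ^ 2 - q = q * (q - 1) := by ring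
    rw [this]
    exact mul_ne_zero hq0 (sub_ne_zero.mpr hq1)
  have ha : x + x / (q ^ 2 - q) * q = q ^ 2 * (x / (q ^ 2 - q)) := by
    field_simp
    ring
  unfold jkOmega
  generalize x / (q ^ 2 - q) = a at ha
  simp only [sub_mul, add_mul, mul_sub, mul_add, smul_mul_assoc, mul_smul_comm, mul_assoc, h.h21,
    h.h01, mul_one, one_mul, smul_sub, smul_add, smul_smul]
  rw [← ha]
  module

lemma jk_two_root_ne {n : ℕ} (hn : 2 ≤ n) (hq : IsPrimitiveRoot q n) : q ≠ 0 ∧ q ≠ 1 :=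
  ⟨hq.ne_zero (by omega), hq.ne_one (by omega)⟩

/-- The commutative subalgebra (the centralizer of `e0`). -/
def jkB (n : ℕ) (q x : K) (e0 e1 e2 : A) : Subalgebra K A :=
  Algebra.adjoin K {e0, jkOmega q x e0 e1 e2, e1 ^ n, e2 ^ n}

lemma JKRel.B_comm (h : JKRel q x e0 e1 e2) {n : ℕ} (hn : 2 ≤ n) (hq : IsPrimitiveRoot q n)
    {a b : A} (ha : a ∈ jkB n q x e0 e1 e2) (hb : b ∈ jkB n q x e0 e1 e2) : Commute a b := by
  obtain ⟨h1, h2, -, -⟩ := h.pow_central hn hq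
  obtain ⟨h3, h4⟩ := h.pow_central' hn hq
  have hO : ∀ y : A, Commute e0 y → Commute e1 y → Commute e2 y →
      Commute (jkOmega q x e0 e1 e2) y := by
    intro y y0 y1 y2
    unfold jkOmega
    exact ((y1.mul_left y2).add_left (y0.smul_left _)).sub_left ((Commute.one_left y).smul_left _)
  have hOY := hO _ h1 (Commute.self_pow e1 n) h2
  have hOZ := hO _ h3 h4 (Commute.self_pow e2 n)
  have hYZ : Commute (e1 ^ n) (e2 ^ n) := h4.pow_left n
  have h0O := h.omega_e0
  have hgen : ∀ u ∈ ({e0, jkOmega q x e0 e1 e2, e1 ^ n, e2 ^ n} : Set A),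
      ∀ v ∈ ({e0, jkOmega q x e0 e1 e2, e1 ^ n, e2 ^ n} : Set A), Commute u v := by
    intro u hu v hv
    simp only [Set.mem_insert_iff, Set.mem_singleton_iff] at hu hv
    rcases hu with rfl | rfl | rfl | rfl <;> rcases hv with rfl | rfl | rfl | rfl <;>
      first | exact Commute.refl _ | assumption | (apply Commute.symm; assumption)
  exact Algebra.commute_of_mem_adjoin_of_forall_mem_commute hb fun v hv =>
    (Algebra.commute_of_mem_adjoin_of_forall_mem_commute ha fun u hu => hgen v hv u hu).symm

lemma JKRel.B_shift (h : JKRel q x e0 e1 e2) {n : ℕ} (hn : 2 ≤ n) (hq : IsPrimitiveRoot q n)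
    {b : A} (hb : b ∈ jkB n q x e0 e1 e2) : ∃ b' ∈ jkB n q x e0 e1 e2, e1 * b = b' * e1 := by
  obtain ⟨hq0, hq1⟩ := jk_two_root_ne hn hq
  have hsub : ∀ y ∈ ({e0, jkOmega q x e0 e1 e2, e1 ^ n, e2 ^ n} : Set A),
    y ∈ jkB n q x e0 e1 e2 := fun y hy => Algebra.subset_adjoin hy
  unfold jkB at hb
  induction hb using Algebra.adjoin_induction with
  | mem y hy =>
    have hyB := hsub y hy
    simp only [Set.mem_insert_iff, Set.mem_singleton_iff] at hy
    rcases hy with rfl | rfl | rfl | rfl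
    · exact ⟨q⁻¹ • y, Subalgebra.smul_mem _ hyB _, by
        rw [smul_mul_assoc]; exact jk_qcomm_symm hq0 h.h01⟩
    · exact ⟨(q ^ 2)⁻¹ • _, Subalgebra.smul_mem _ hyB _, by
        rw [smul_mul_assoc]; exact jk_qcomm_symm (pow_ne_zero 2 hq0) (h.omega_e1 hq0 hq1)⟩
    · exact ⟨_, hyB, Commute.self_pow e1 n⟩
    · exact ⟨_, hyB, (h.pow_central' hn hq).2⟩
  | algebraMap r => exact ⟨_, Subalgebra.algebraMap_mem _ r, (Algebra.commutes r e1).symm⟩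
  | add a b _ _ ha hb =>
    obtain ⟨a', ha', ha⟩ := ha
    obtain ⟨b', hb', hb⟩ := hb
    exact ⟨a' + b', add_mem ha' hb', by rw [mul_add, ha, hb, add_mul]⟩
  | mul a b _ _ ha hb =>
    obtain ⟨a', ha', ha⟩ := ha
    obtain ⟨b', hb', hb⟩ := hb
    exact ⟨a' * b', mul_mem ha' hb', by rw [← mul_assoc, ha, mul_assoc, hb, mul_assoc]⟩

/-- the sequence of shifts of an element of `B`. -/
lemma JKRel.B_seq (h : JKRel q x e0 e1 e2) {n : ℕ} (hn : 2 ≤ n) (hq : IsPrimitiveRoot q n)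
    {b : A} (hb : b ∈ jkB n q x e0 e1 e2) : ∃ s : ℕ → A, s 0 = b ∧
      (∀ j, s j ∈ jkB n q x e0 e1 e2) ∧ (∀ j, e1 * s j = s (j + 1) * e1) ∧
      ∀ j, e1 ^ j * b = s j * e1 ^ j := by
  choose f hf1 hf2 using fun b : jkB n q x e0 e1 e2 => h.B_shift hn hq b.2
  let t : ℕ → jkB n q x e0 e1 e2 := fun j => Nat.rec ⟨b, hb⟩ (fun _ c => ⟨f c, hf1 c⟩) j
  have ht : ∀ j : ℕ, e1 * (t j).1 = (t (j + 1)).1 * e1 := fun j => hf2 (t j)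
  refine ⟨fun j => (t j).1, rfl, fun j => (t j).2, ht, ?_⟩
  intro j
  induction j with
  | zero => simp [t]
  | succ j ih => rw [pow_succ', mul_assoc, ih, ← mul_assoc, ht, mul_assoc]

lemma JKRel.e1e2_mem (n : ℕ) : e1 * e2 ∈ jkB n q x e0 e1 e2 := by
  have hsub : ∀ y ∈ ({e0, jkOmega q x e0 e1 e2, e1 ^ n, e2 ^ n} : Set A),
    y ∈ jkB n q x e0 e1 e2 := fun y hy => Algebra.subset_adjoin hy
  have : e1 * e2 = jkOmega q x e0 e1 e2 - (x / (q ^ 2 - q)) • e0 + x • (1 : A) := by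
    unfold jkOmega; abel
  rw [this]
  exact add_mem (sub_mem (hsub _ (by simp)) (Subalgebra.smul_mem _ (hsub _ (by simp)) _))
    (Subalgebra.smul_mem _ (one_mem _) _)

lemma JKRel.e1e2_pow_mem (h : JKRel q x e0 e1 e2) {n : ℕ} (hn : 2 ≤ n) (hq : IsPrimitiveRoot q n)
    (k : ℕ) : e1 ^ k * e2 ^ k ∈ jkB n q x e0 e1 e2 := by
  induction k with
  | zero => simp
  | succ k ih =>
    obtain ⟨s, -, hs, -, hs'⟩ := h.B_seq hn hq (JKRel.e1e2_mem (q := q) (x := x) (e0 := e0) n)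
    have : e1 ^ (k + 1) * e2 ^ (k + 1) = s k * (e1 ^ k * e2 ^ k) := by
      rw [← mul_assoc, ← hs', pow_succ, pow_succ']
      simp only [mul_assoc]
    rw [this]
    exact mul_mem (hs k) ih

lemma JKRel.mono_mem (h : JKRel q x e0 e1 e2) {n : ℕ} (hn : 2 ≤ n) (hq : IsPrimitiveRoot q n)
    (i j k : ℕ) (hjk : j ≡ k [MOD n]) : e0 ^ i * e1 ^ j * e2 ^ k ∈ jkB n q x e0 e1 e2 := by
  have hsub : ∀ y ∈ ({e0, jkOmega q x e0 e1 e2, e1 ^ n, e2 ^ n} : Set A),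
    y ∈ jkB n q x e0 e1 e2 := fun y hy => Algebra.subset_adjoin hy
  rw [mul_assoc]
  refine mul_mem (pow_mem (hsub _ (by simp)) i) ?_
  rcases le_total j k with hle | hle
  · obtain ⟨l, hl⟩ := (Nat.modEq_iff_dvd' hle).mp hjk
    obtain rfl : k = j + n * l := by omega
    rw [pow_add, pow_mul, ← mul_assoc]
    exact mul_mem (h.e1e2_pow_mem hn hq j) (pow_mem (hsub _ (by simp)) l)
  · obtain ⟨l, hl⟩ := (Nat.modEq_iff_dvd' hle).mp hjk.symm
    obtain rfl : j = n * l + k := by omega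
    rw [pow_add, pow_mul, mul_assoc]
    exact mul_mem (pow_mem (hsub _ (by simp)) l) (h.e1e2_pow_mem hn hq k)

/-- Averaging operator. -/
def jkAvg (n : ℕ) (e : A) : A →ₗ[K] A :=
  ∑ i ∈ Finset.range n, (LinearMap.mulLeft K (e ^ i)) ∘ₗ (LinearMap.mulRight K (e ^ (n - i)))

lemma jkAvg_apply (n : ℕ) (e a : A) :
    jkAvg (K := K) n e a = ∑ i ∈ Finset.range n, e ^ i * a * e ^ (n - i) := by
  simp [jkAvg, LinearMap.sum_apply, mul_assoc]

lemma jkAvg_central_mul (n : ℕ) (e a z : A) (hz : Commute z e) :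
    jkAvg (K := K) n e (z * a) = z * jkAvg (K := K) n e a := by
  rw [jkAvg_apply, jkAvg_apply, Finset.mul_sum]
  refine Finset.sum_congr rfl fun i _ => ?_
  rw [← mul_assoc, ← (hz.pow_right i).eq]
  simp only [mul_assoc]

lemma jkAvg_one (n : ℕ) (e : A) : jkAvg (K := K) n e 1 = (n : K) • e ^ n := by
  rw [jkAvg_apply]
  rw [Finset.sum_congr rfl (g := fun _ => e ^ n)]
  · simp [Nat.cast_smul_eq_nsmul]
  · intro i hi
    rw [mul_one, ← pow_add]
    congr 1
    have := Finset.mem_range.mp hi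
    omega

/-- Step one of the projection. -/
lemma JKRel.avg_mono (h : JKRel q x e0 e1 e2) {n : ℕ} (hn : 2 ≤ n) (hq : IsPrimitiveRoot q n)
    (i j k : ℕ) : ∃ b ∈ jkB n q x e0 e1 e2,
      jkAvg (K := K) n e0 (e0 ^ i * e1 ^ j * e2 ^ k) = b * e0 ^ n := by
  obtain ⟨hq0, hq1⟩ := jk_two_root_ne hn hq
  set m := e0 ^ i * e1 ^ j * e2 ^ k with hm
  have hcomm : e0 * m = (q ^ j * (q⁻¹) ^ k) • (m * e0) := by
    have h1 := jk_qcomm_pow h.h01 j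
    have h2 := jk_qcomm_pow (jk_qcomm_symm hq0 h.h20) k
    rw [hm]
    calc e0 * (e0 ^ i * e1 ^ j * e2 ^ k) = e0 ^ i * (e0 * e1 ^ j) * e2 ^ k := by
          rw [← mul_assoc, ← mul_assoc, ← pow_succ', pow_succ, ← mul_assoc]
      _ = _ := by
          rw [h1, mul_smul_comm, smul_mul_assoc, mul_assoc, mul_assoc, h2]
          simp only [mul_smul_comm, smul_smul, mul_assoc]
  set μ := q ^ j * (q⁻¹) ^ k with hμ
  have hsum : jkAvg (K := K) n e0 m = (∑ l ∈ Finset.range n, μ ^ l) • (m * e0 ^ n) := by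
    rw [jkAvg_apply, Finset.sum_smul]
    refine Finset.sum_congr rfl fun l hl => ?_
    rw [jk_qcomm_pow_left hcomm l, smul_mul_assoc, mul_assoc, ← pow_add]
    congr 4
    have := Finset.mem_range.mp hl
    omega
  by_cases hjk : j ≡ k [MOD n]
  · refine ⟨(∑ l ∈ Finset.range n, μ ^ l) • m, Subalgebra.smul_mem _ (h.mono_mem hn hq i j k hjk) _, ?_⟩
    rw [hsum, smul_mul_assoc]
  · refine ⟨0, zero_mem _, ?_⟩
    have hμ1 : μ ≠ 1 := by
      intro h1
      apply hjk
      rw [hμ, inv_pow, mul_inv_eq_one₀ (pow_ne_zero _ hq0)] at h1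
      obtain rfl := hq.eq_orderOf
      have hu : (hq.isUnit (by omega)).unit ^ j = (hq.isUnit (by omega)).unit ^ k := by
        ext; simpa using h1
      rw [pow_eq_pow_iff_modEq, ← orderOf_units] at hu
      simpa using hu
    have hμn : μ ^ n = 1 := by
      rw [hμ, mul_pow, ← pow_mul, ← pow_mul, mul_comm j, mul_comm k, pow_mul, pow_mul, inv_pow,
        hq.pow_eq_one]
      simp
    have : ∑ l ∈ Finset.range n, μ ^ l = 0 := by
      rw [geom_sum_eq hμ1, hμn]; simp
    rw [hsum, this]; simp

/-- The PBW hypothesis. -/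
def JKPBW (b : Module.Basis (ℕ × ℕ × ℕ) K A) (e0 e1 e2 : A) : Prop :=
  ∀ i j k, b (i, j, k) = e0 ^ i * e1 ^ j * e2 ^ k

variable {b : Module.Basis (ℕ × ℕ × ℕ) K A}

lemma JKPBW.span (hb : JKPBW b e0 e1 e2) (S : Submodule K A)
    (hS : ∀ i j k, e0 ^ i * e1 ^ j * e2 ^ k ∈ S) (a : A) : a ∈ S := by
  have : (⊤ : Submodule K A) ≤ S := by
    rw [← b.span_eq, Submodule.span_le]
    rintro _ ⟨⟨i, j, k⟩, rfl⟩
    rw [hb]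
    exact hS i j k
  exact this trivial

lemma JKPBW.central (hb : JKPBW b e0 e1 e2) {z : A} (h0 : Commute e0 z) (h1 : Commute e1 z)
    (h2 : Commute e2 z) : z ∈ Subalgebra.center K A := by
  rw [Subalgebra.mem_center_iff]
  have : ∀ a : A, a ∈ Subalgebra.toSubmodule (Subalgebra.centralizer K {z}) := by
    apply hb.span
    intro i j k
    rw [Subalgebra.mem_toSubmodule, Subalgebra.mem_centralizer_iff]
    rintro _ rfl
    exact (((h0.pow_left i).mul_left (h1.pow_left j)).mul_left (h2.pow_left k)).symm
  intro a
  have := this a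
  rw [Subalgebra.mem_toSubmodule, Subalgebra.mem_centralizer_iff] at this
  exact (this z rfl).symm

lemma JKPBW.avg0 (hb : JKPBW b e0 e1 e2) (h : JKRel q x e0 e1 e2) {n : ℕ} (hn : 2 ≤ n)
    (hq : IsPrimitiveRoot q n) (a : A) : ∃ b ∈ jkB n q x e0 e1 e2,
      jkAvg (K := K) n e0 a = b * e0 ^ n := by
  have : a ∈ Submodule.comap (jkAvg (K := K) n e0)
      ((Subalgebra.toSubmodule (jkB n q x e0 e1 e2)).map (LinearMap.mulRight K (e0 ^ n))) := by
    apply hb.span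
    intro i j k
    obtain ⟨c, hc, hc'⟩ := h.avg_mono hn hq i j k
    exact ⟨c, hc, hc'.symm⟩
  obtain ⟨c, hc, hc'⟩ := this
  exact ⟨c, hc, hc'.symm⟩

lemma jk_left_inj (b : Module.Basis (ℕ × ℕ × ℕ) K A) (e : A) (g : ℕ × ℕ × ℕ → ℕ × ℕ × ℕ)
    (hg : Function.Injective g) (c : ℕ × ℕ × ℕ → K) (hc : ∀ p, c p ≠ 0)
    (he : ∀ p, e * b p = c p • b (g p)) (a : A) (ha : e * a = 0) : a = 0 := by
  have hli : LinearIndependent K (fun p => e * b p) := by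
    have h1 : LinearIndependent K (fun p => b (g p)) := b.linearIndependent.comp g hg
    have h2 := h1.units_smul (fun p => Units.mk0 (c p) (hc p))
    convert h2 using 2 with p
    rw [he]; rfl
  have hinj : Function.Injective (LinearMap.mulLeft K e) := by
    have h3 : Finsupp.linearCombination K (fun p => e * b p) =
        LinearMap.mulLeft K e ∘ₗ b.repr.symm.toLinearMap := by
      ext p; simp
    have h4 : Function.Injective (Finsupp.linearCombination K (fun p => e * b p)) := hli
    rw [h3] at h4
    intro u v huv
    have := @h4 (b.repr u) (b.repr v) (by simpa using huv)
    exact b.repr.injective this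
  exact hinj (by simpa using ha)

lemma JKPBW.e0_reg (hb : JKPBW b e0 e1 e2) (a : A) (ha : e0 * a = 0) : a = 0 := by
  refine jk_left_inj b e0 (fun p => (p.1 + 1, p.2)) ?_ (fun _ => 1) (fun _ => one_ne_zero) ?_ a ha
  · rintro ⟨i, j⟩ ⟨i', j'⟩ h
    simp at h
    simpa using h
  · rintro ⟨i, j, k⟩
    simp [hb i j k, hb (i + 1) j k, pow_succ', mul_assoc]

lemma JKPBW.e1_reg (hb : JKPBW b e0 e1 e2) (h : JKRel q x e0 e1 e2) (hq0 : q ≠ 0)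
    (a : A) (ha : e1 * a = 0) : a = 0 := by
  refine jk_left_inj b e1 (fun p => (p.1, p.2.1 + 1, p.2.2)) ?_ (fun p => (q⁻¹) ^ p.1)
    (fun _ => pow_ne_zero _ (inv_ne_zero hq0)) ?_ a ha
  · rintro ⟨i, j, k⟩ ⟨i', j', k'⟩ h
    simp at h
    simpa using h
  · rintro ⟨i, j, k⟩
    simp only [hb i j k, hb i (j + 1) k]
    rw [← mul_assoc, ← mul_assoc, jk_qcomm_pow (jk_qcomm_symm hq0 h.h01) i, pow_succ' e1]
    simp only [smul_mul_assoc, mul_assoc]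

lemma jk_pow_reg {e : A} (he : ∀ a : A, e * a = 0 → a = 0) (n : ℕ) (a : A) (ha : e ^ n * a = 0) :
    a = 0 := by
  induction n with
  | zero => simpa using ha
  | succ n ih =>
    rw [pow_succ', mul_assoc] at ha
    exact ih (he _ ha)

/-- Step two of the projection. -/
lemma JKPBW.avg1 (hb : JKPBW b e0 e1 e2) (h : JKRel q x e0 e1 e2) {n : ℕ} (hn : 2 ≤ n)
    (hq : IsPrimitiveRoot q n) {c : A} (hc : c ∈ jkB n q x e0 e1 e2) :
    ∃ z ∈ Subalgebra.center K A, jkAvg (K := K) n e1 c = e1 ^ n * z := by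
  obtain ⟨hq0, hq1⟩ := jk_two_root_ne hn hq
  obtain ⟨s, hs0, hsB, hs1, hsn⟩ := h.B_seq hn hq hc
  have he1 := hb.e1_reg h hq0
  obtain ⟨hY0, hY2, hX1, hX2⟩ := h.pow_central hn hq
  have hY : ∀ a, a * e1 ^ n = e1 ^ n * a :=
    Subalgebra.mem_center_iff.mp (hb.central hY0 (Commute.self_pow e1 n) hY2)
  have hcyc : s n = c := by
    have h1 := hsn n
    rw [hY, ← sub_eq_zero, ← mul_sub] at h1
    exact (sub_eq_zero.mp (jk_pow_reg he1 n _ h1)).symm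
  set z := ∑ j ∈ Finset.range n, s j with hz
  have hzB : z ∈ jkB n q x e0 e1 e2 := sum_mem fun j _ => hsB j
  have hz1 : Commute e1 z := by
    change e1 * z = z * e1
    have h2 : ∑ j ∈ Finset.range n, s (j + 1) = ∑ j ∈ Finset.range n, s j := by
      have h3 := Finset.sum_range_succ s n
      rw [Finset.sum_range_succ' s n, hcyc, hs0] at h3
      exact add_right_cancel h3
    rw [hz, Finset.mul_sum, ← h2, Finset.sum_mul]
    exact Finset.sum_congr rfl fun j _ => hs1 j
  have hz0 : Commute e0 z := h.B_comm hn hq (Algebra.subset_adjoin (by simp)) hzB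
  have hz12 : Commute (e1 * e2) z := h.B_comm hn hq (JKRel.e1e2_mem n) hzB
  have hz2 : Commute e2 z := by
    change e2 * z = z * e2
    rw [← sub_eq_zero]
    apply he1
    rw [mul_sub, ← mul_assoc, ← mul_assoc, hz12.eq, hz1.eq, mul_assoc, sub_self]
  refine ⟨z, hb.central hz0 hz1 hz2, ?_⟩
  rw [jkAvg_apply, hz, Finset.mul_sum]
  refine Finset.sum_congr rfl fun j hj => ?_
  have : j + (n - j) = n := by
    have := Finset.mem_range.mp hj
    omega
  rw [hsn, mul_assoc, ← pow_add, this, hY]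

end JKAlg

section JKPBWProof

variable {K : Type*} [Field K]

/-- Basis vector of the PBW model. -/
noncomputable def jkm (i j k : ℕ) : (ℕ × ℕ × ℕ) →₀ K := Finsupp.single (i, j, k) 1

noncomputable def jkE0 : Module.End K ((ℕ × ℕ × ℕ) →₀ K) :=
  Finsupp.linearCombination K (fun p => jkm (p.1 + 1) p.2.1 p.2.2)

noncomputable def jkE1 (q : K) : Module.End K ((ℕ × ℕ × ℕ) →₀ K) :=
  Finsupp.linearCombination K (fun p => (q⁻¹) ^ p.1 • jkm p.1 (p.2.1 + 1) p.2.2)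

noncomputable def jkE2 (q x : K) : Module.End K ((ℕ × ℕ × ℕ) →₀ K) :=
  Finsupp.linearCombination K (fun p => q ^ (p.1 + 2 * p.2.1) • jkm p.1 p.2.1 (p.2.2 + 1)
    + (q ^ p.1 * (x * ∑ l ∈ Finset.range p.2.1, q ^ l)) • jkm (p.1 + 1) (p.2.1 - 1) p.2.2
    + (q ^ p.1 * (x * (1 - q ^ (2 * p.2.1)))) • jkm p.1 (p.2.1 - 1) p.2.2)

lemma jkE0_m (i j k : ℕ) : jkE0 (K := K) (jkm i j k) = jkm (i + 1) j k := by
  simp [jkE0, jkm]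

lemma jkE1_m (q : K) (i j k : ℕ) : jkE1 q (jkm i j k) = (q⁻¹) ^ i • jkm i (j + 1) k := by
  simp [jkE1, jkm]

lemma jkE2_m (q x : K) (i j k : ℕ) : jkE2 q x (jkm i j k) =
    q ^ (i + 2 * j) • jkm i j (k + 1)
    + (q ^ i * (x * ∑ l ∈ Finset.range j, q ^ l)) • jkm (i + 1) (j - 1) k
    + (q ^ i * (x * (1 - q ^ (2 * j)))) • jkm i (j - 1) k := by
  simp only [jkE2]
  conv_lhs => rw [jkm, Finsupp.linearCombination_single, one_smul]

lemma jk_end_ext {f g : Module.End K ((ℕ × ℕ × ℕ) →₀ K)}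
    (h : ∀ i j k, f (jkm i j k) = g (jkm i j k)) : f = g := by
  apply Finsupp.lhom_ext'
  rintro ⟨i, j, k⟩
  apply LinearMap.ext_ring
  exact h i j k

lemma jkE_rel (q x : K) (hq : q ≠ 0) : JKRel q x jkE0 (jkE1 q) (jkE2 q x) where
  h01 := by
    apply jk_end_ext
    intro i j k
    simp only [Module.End.mul_apply, LinearMap.smul_apply, jkE0_m, jkE1_m, map_smul, smul_smul]
    congr 1
    rw [pow_succ]; field_simp
  h20 := by
    apply jk_end_ext
    intro i j k
    simp only [Module.End.mul_apply, LinearMap.smul_apply, jkE0_m, jkE2_m, map_smul, map_add]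
    module
  h21 := by
    apply jk_end_ext
    intro i j k
    have hqq : q ^ i * (q⁻¹) ^ i = 1 := by rw [← mul_pow, mul_inv_cancel₀ hq, one_pow]
    generalize hp : (q⁻¹) ^ i = p at hqq
    have hp' : (q⁻¹) ^ (i + 1) = q⁻¹ * p := by rw [pow_succ', hp]
    have hq' : q * q⁻¹ = 1 := mul_inv_cancel₀ hq
    simp only [Module.End.mul_apply, LinearMap.smul_apply, LinearMap.add_apply, jkE0_m, jkE1_m,
      jkE2_m, map_smul, map_add, Module.End.one_apply, hp, hp', Nat.add_sub_cancel]
    rw [geom_sum_succ]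
    rcases j with _ | j
    · simp only [Finset.sum_range_zero]
      match_scalars
      · linear_combination (q ^ 2) * hqq - (q ^ 2) * hqq
      · linear_combination x * hqq
      · linear_combination (x * (1 - q ^ 2)) * hqq
      · simp
      · simp
    · rw [Nat.add_sub_cancel]
      generalize ∑ l ∈ Finset.range (j + 1), q ^ l = S
      match_scalars
      · ring
      · linear_combination x * (q * S + 1) * hqq - q ^ 2 * q⁻¹ * x * S * hqq - x * S * q * hq'
      · linear_combination (x * (1 - q ^ (2 * j + 4)) - q ^ 2 * x * (1 - q ^ (2 * j + 2))) * hqq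

lemma jkE_pow (q x : K) (i j k : ℕ) :
    (jkE0 ^ i * jkE1 q ^ j * jkE2 q x ^ k : Module.End K ((ℕ × ℕ × ℕ) →₀ K)) (jkm 0 0 0) =
      jkm i j k := by
  have h2 : ∀ k, (jkE2 q x ^ k) (jkm 0 0 0) = jkm 0 0 k := by
    intro k
    induction k with
    | zero => simp
    | succ k ih => rw [pow_succ', Module.End.mul_apply, ih, jkE2_m]; simp
  have h1 : ∀ j, (jkE1 q ^ j) (jkm 0 0 k) = jkm 0 j k := by
    intro j
    induction j with
    | zero => simp
    | succ j ih => rw [pow_succ', Module.End.mul_apply, ih, jkE1_m]; simp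
  have h0 : ∀ i, (jkE0 (K := K) ^ i) (jkm 0 j k) = jkm i j k := by
    intro i
    induction i with
    | zero => simp
    | succ i ih => rw [pow_succ', Module.End.mul_apply, ih, jkE0_m]
  rw [Module.End.mul_apply, Module.End.mul_apply, h2, h1, h0]

theorem jk_pbw {A : Type*} [Ring A] [Algebra K A] {q x : K} {e0 e1 e2 : A}
    (h : JKRel q x e0 e1 e2) (hq : q ≠ 0) (φ : A →ₐ[K] Module.End K ((ℕ × ℕ × ℕ) →₀ K))
    (hφ0 : φ e0 = jkE0) (hφ1 : φ e1 = jkE1 q) (hφ2 : φ e2 = jkE2 q x)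
    (hgen : Algebra.adjoin K {e0, e1, e2} = ⊤) :
    ∃ b : Module.Basis (ℕ × ℕ × ℕ) K A, JKPBW b e0 e1 e2 := by
  set v : ℕ × ℕ × ℕ → A := fun p => e0 ^ p.1 * e1 ^ p.2.1 * e2 ^ p.2.2 with hv
  have hli : LinearIndependent K v := by
    let ψ : A →ₗ[K] ((ℕ × ℕ × ℕ) →₀ K) := (LinearMap.applyₗ (jkm 0 0 0)) ∘ₗ φ.toLinearMap
    apply LinearIndependent.of_comp ψ
    have : ψ ∘ v = Finsupp.basisSingleOne (R := K) := by
      funext p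
      obtain ⟨i, j, k⟩ := p
      change φ (e0 ^ i * e1 ^ j * e2 ^ k) (jkm 0 0 0) = _
      rw [map_mul, map_mul, map_pow, map_pow, map_pow, hφ0, hφ1, hφ2, jkE_pow]
      simp [jkm]
    rw [this]
    exact Finsupp.basisSingleOne.linearIndependent
  set S := Submodule.span K (Set.range v) with hS
  have hmem : ∀ i j k, e0 ^ i * e1 ^ j * e2 ^ k ∈ S :=
    fun i j k => Submodule.subset_span ⟨(i, j, k), rfl⟩
  have key : ∀ e : A, (∀ i j k, e * (e0 ^ i * e1 ^ j * e2 ^ k) ∈ S) → ∀ s ∈ S, e * s ∈ S := by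
    intro e he s hs
    have : S ≤ S.comap (LinearMap.mulLeft K e) := by
      rw [hS, Submodule.span_le]
      rintro _ ⟨⟨i, j, k⟩, rfl⟩
      exact he i j k
    exact this hs
  have k0 := key e0 (fun i j k => by
    rw [← mul_assoc, ← mul_assoc, ← pow_succ']; exact hmem _ _ _)
  have k1 := key e1 (fun i j k => by
    rw [← mul_assoc, ← mul_assoc, jk_qcomm_pow (jk_qcomm_symm hq h.h01) i]
    rw [smul_mul_assoc, smul_mul_assoc, mul_assoc (e0 ^ i), ← pow_succ']
    exact S.smul_mem _ (hmem _ _ _))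
  have k2 := key e2 (fun i j k => by
    rw [← mul_assoc, ← mul_assoc, jk_qcomm_pow h.h20 i]
    rw [smul_mul_assoc, smul_mul_assoc, mul_assoc (e0 ^ i)]
    apply S.smul_mem
    rcases j with _ | j
    · rw [pow_zero, mul_one, mul_assoc, ← pow_succ']
      simpa using hmem i 0 (k + 1)
    · rw [h.e2_e1_pow hq j]
      simp only [mul_add, add_mul, mul_smul_comm, smul_mul_assoc]
      refine add_mem (add_mem ?_ ?_) ?_ <;> apply S.smul_mem
      · rw [← mul_assoc, mul_assoc _ e2, ← pow_succ']; exact hmem _ _ _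
      · rw [← mul_assoc, ← pow_succ]; exact hmem _ _ _
      · exact hmem _ _ _)
  have hall : ∀ a : A, ∀ s ∈ S, a * s ∈ S := by
    intro a
    have ha : a ∈ Algebra.adjoin K {e0, e1, e2} := by rw [hgen]; trivial
    induction ha using Algebra.adjoin_induction with
    | mem y hy =>
      simp only [Set.mem_insert_iff, Set.mem_singleton_iff] at hy
      rcases hy with rfl | rfl | rfl <;> assumption
    | algebraMap r => intro s hs; rw [← Algebra.smul_def]; exact S.smul_mem _ hs
    | add a b _ _ ha hb => intro s hs; rw [add_mul]; exact add_mem (ha s hs) (hb s hs)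
    | mul a b _ _ ha hb => intro s hs; rw [mul_assoc]; exact ha _ (hb s hs)
  have hsp : ⊤ ≤ S := by
    intro a _
    have := hall a 1 (by simpa using hmem 0 0 0)
    rwa [mul_one] at this
  exact ⟨Module.Basis.mk hli hsp, fun i j k => by simp [hv]⟩

noncomputable def jkGen (K : Type*) [Field K] (ζ : K) (r : ℤ) (x : K) (i : Fin 3) :
    Jackson K ζ r x := RingQuot.mkAlgHom K (JacksonRel K ζ r x) (FreeAlgebra.ι K i)

lemma jkGen_rel (ζ : K) (r : ℤ) (x : K) :
    JKRel (ζ ^ r) x (jkGen K ζ r x 0) (jkGen K ζ r x 1) (jkGen K ζ r x 2) where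
  h01 := by
    have := RingQuot.mkAlgHom_rel K (JacksonRel.r01 (K := K) (ζ := ζ) (r := r) (x := x))
    simpa only [map_mul, map_smul, jkGen] using this
  h20 := by
    have := RingQuot.mkAlgHom_rel K (JacksonRel.r20 (K := K) (ζ := ζ) (r := r) (x := x))
    simpa only [map_mul, map_smul, jkGen] using this
  h21 := by
    have := RingQuot.mkAlgHom_rel K (JacksonRel.r21 (K := K) (ζ := ζ) (r := r) (x := x))
    have e : ζ ^ (2 * r) = (ζ ^ r) ^ 2 := by
      rw [mul_comm, zpow_mul]; norm_cast
    rw [e] at this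
    simpa only [map_mul, map_smul, map_add, map_one, jkGen] using this

theorem jackson_pbw (ζ : K) (r : ℤ) (x : K) (hq : ζ ^ r ≠ 0) :
    ∃ b : Module.Basis (ℕ × ℕ × ℕ) K (Jackson K ζ r x),
      JKPBW b (jkGen K ζ r x 0) (jkGen K ζ r x 1) (jkGen K ζ r x 2) := by
  let g : Fin 3 → Module.End K ((ℕ × ℕ × ℕ) →₀ K) := ![jkE0, jkE1 (ζ ^ r), jkE2 (ζ ^ r) x]
  have e : ζ ^ (2 * r) = (ζ ^ r) ^ 2 := by
    rw [mul_comm, zpow_mul]; norm_cast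
  have hE := jkE_rel (ζ ^ r) x hq
  have hrel : ∀ ⦃a b : FreeAlgebra K (Fin 3)⦄, JacksonRel K ζ r x a b →
      FreeAlgebra.lift K g a = FreeAlgebra.lift K g b := by
    intro a b hab
    cases hab with
    | r01 => simpa [g] using hE.h01
    | r20 => simpa [g] using hE.h20
    | r21 =>
      rw [e]
      simp only [map_mul, map_smul, map_add, map_one, FreeAlgebra.lift_ι_apply]
      exact hE.h21
  let φ : Jackson K ζ r x →ₐ[K] Module.End K ((ℕ × ℕ × ℕ) →₀ K) :=
    RingQuot.liftAlgHom K ⟨FreeAlgebra.lift K g, hrel⟩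
  have hφ : ∀ i, φ (jkGen K ζ r x i) = g i := by
    intro i
    simp [φ, jkGen, RingQuot.liftAlgHom_mkAlgHom_apply]
  refine jk_pbw (jkGen_rel ζ r x) hq φ (hφ 0) (hφ 1) (hφ 2) ?_
  have h1 : Algebra.adjoin K (Set.range (FreeAlgebra.ι K (X := Fin 3))) = ⊤ :=
    FreeAlgebra.adjoin_range_ι K (Fin 3)
  have h2 := congrArg (Subalgebra.map (RingQuot.mkAlgHom K (JacksonRel K ζ r x))) h1
  rw [AlgHom.map_adjoin, Algebra.map_top,
    (AlgHom.range_eq_top _).mpr (RingQuot.mkAlgHom_surjective K _)] at h2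
  rw [← h2]
  congr 1
  rw [← Set.range_comp]
  ext a
  simp only [Set.mem_insert_iff, Set.mem_singleton_iff, Set.mem_range, Fin.exists_fin_succ]
  simp [jkGen, eq_comm]

end JKPBWProof

section JKMain

variable {K A : Type*} [Field K] [Ring A] [Algebra K A] {q x : K} {e0 e1 e2 : A}
variable {b : Module.Basis (ℕ × ℕ × ℕ) K A}

lemma JKPBW.retract [CharZero K] (hb : JKPBW b e0 e1 e2) (h : JKRel q x e0 e1 e2) {n : ℕ}
    (hn : 2 ≤ n) (hq : IsPrimitiveRoot q n) :
    ∃ ρ : A →ₗ[Subalgebra.center K A] Subalgebra.center K A,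
      ∀ z : Subalgebra.center K A, ρ (z : A) = z := by
  obtain ⟨hq0, hq1⟩ := jk_two_root_ne hn hq
  obtain ⟨hY0, hY2, hX1, hX2⟩ := h.pow_central hn hq
  have hX : ∀ a, a * e0 ^ n = e0 ^ n * a :=
    Subalgebra.mem_center_iff.mp (hb.central (Commute.self_pow e0 n) hX1 hX2)
  set F : A →ₗ[K] A := jkAvg (K := K) n e1 ∘ₗ jkAvg (K := K) n e0 with hF
  have hcen : ∀ z : Subalgebra.center K A, ∀ a, Commute (z : A) a := fun z a =>
    (Subalgebra.mem_center_iff.mp z.2 a).symm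
  have hFz : ∀ (z : Subalgebra.center K A) a, F (z * a) = z * F a := by
    intro z a
    simp only [hF, LinearMap.comp_apply]
    rw [jkAvg_central_mul _ _ _ _ (hcen z _), jkAvg_central_mul _ _ _ _ (hcen z _)]
  have hreg : ∀ a, e0 ^ n * (e1 ^ n * a) = 0 → a = 0 := fun a ha =>
    jk_pow_reg (hb.e1_reg h hq0) n _ (jk_pow_reg hb.e0_reg n _ ha)
  have hreg' : ∀ a c, e0 ^ n * (e1 ^ n * a) = e0 ^ n * (e1 ^ n * c) → a = c := by
    intro a c hac
    rw [← sub_eq_zero, ← mul_sub, ← mul_sub] at hac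
    exact sub_eq_zero.mp (hreg _ hac)
  have hex : ∀ a, ∃ z : Subalgebra.center K A, F a = e0 ^ n * (e1 ^ n * z) := by
    intro a
    obtain ⟨c, hc, hca⟩ := hb.avg0 h hn hq a
    obtain ⟨z, hz, hzc⟩ := hb.avg1 h hn hq hc
    refine ⟨⟨z, hz⟩, ?_⟩
    simp only [hF, LinearMap.comp_apply]
    rw [hca, hX, jkAvg_central_mul _ _ _ _ (hX e1).symm, hzc]
  choose ρ hρ using hex
  have hn0 : (n : K) ≠ 0 := by
    have : n ≠ 0 := by omega
    exact_mod_cast this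
  have hF1 : F 1 = e0 ^ n * (e1 ^ n * algebraMap K A ((n : K) ^ 2)) := by
    simp only [hF, LinearMap.comp_apply]
    rw [jkAvg_one, map_smul]
    have : e0 ^ n = e0 ^ n * 1 := (mul_one _).symm
    rw [this, jkAvg_central_mul _ _ _ _ (hX e1).symm, jkAvg_one, Algebra.algebraMap_eq_smul_one,
      mul_one]
    simp only [mul_smul_comm, smul_smul, mul_one, pow_two]
  let ρ' : A →ₗ[Subalgebra.center K A] Subalgebra.center K A :=
    { toFun := ρ
      map_add' := fun a c => by
        apply Subtype.ext
        apply hreg'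
        rw [← hρ, map_add, hρ, hρ]
        push_cast
        simp only [mul_add]
      map_smul' := fun z a => by
        apply Subtype.ext
        apply hreg'
        rw [← hρ]
        change F ((z : A) * a) = e0 ^ n * (e1 ^ n * ((z : A) * (ρ a : A)))
        rw [hFz, hρ]
        rw [← mul_assoc, (hcen z _).eq, mul_assoc, ← mul_assoc (z : A), (hcen z _).eq, mul_assoc] }
  refine ⟨(algebraMap K (Subalgebra.center K A) ((n : K) ^ 2)⁻¹) • ρ', fun z => ?_⟩
  have h1 : ρ' 1 = algebraMap K (Subalgebra.center K A) ((n : K) ^ 2) := by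
    apply Subtype.ext
    apply hreg'
    change e0 ^ n * (e1 ^ n * (ρ 1 : A)) = _
    rw [← hρ, hF1]
    rfl
  have h2 : ρ' (z : A) = z * algebraMap K (Subalgebra.center K A) ((n : K) ^ 2) := by
    have h3 := ρ'.map_smul z 1
    rw [h1] at h3
    rw [← smul_eq_mul, ← h3]
    congr 1
    change (z : A) = z * 1
    rw [mul_one]
  rw [LinearMap.smul_apply, h2, smul_eq_mul, mul_comm, mul_assoc, ← map_mul,
    mul_inv_cancel₀ (pow_ne_zero 2 hn0), map_one, mul_one]

/-- Division with remainder on exponents. -/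
noncomputable def jkIdx (n : ℕ) [NeZero n] :
    (Σ _ : Fin n × Fin n × Fin n, (Fin 3 →₀ ℕ)) ≃ ℕ × ℕ × ℕ where
  toFun p := (n * p.2 0 + p.1.1, n * p.2 1 + p.1.2.1, n * p.2 2 + p.1.2.2)
  invFun a := ⟨(Fin.ofNat n a.1, Fin.ofNat n a.2.1, Fin.ofNat n a.2.2),
    Finsupp.equivFunOnFinite.symm ![a.1 / n, a.2.1 / n, a.2.2 / n]⟩
  left_inv := by
    rintro ⟨⟨i, j, k⟩, d⟩
    have hn : 0 < n := Nat.pos_of_ne_zero (NeZero.ne n)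
    have hm : ∀ (c : ℕ) (i : Fin n), Fin.ofNat n (n * c + i) = i := by
      intro c i
      apply Fin.ext
      simp [Fin.ofNat, Nat.mul_add_mod, Nat.mod_eq_of_lt i.2]
    have hd : ∀ (c : ℕ) (i : Fin n), (n * c + i) / n = c := by
      intro c i
      rw [Nat.mul_add_div hn, Nat.div_eq_of_lt i.2, add_zero]
    simp only [hm, hd]
    congr 1
    ext l
    fin_cases l <;> simp
  right_inv := by
    rintro ⟨i, j, k⟩
    simp [Fin.ofNat, Nat.div_add_mod]

lemma JKPBW.free (hb : JKPBW b e0 e1 e2) {n : ℕ} [NeZero n]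
    (c0 : ∀ a, a * e0 ^ n = e0 ^ n * a) (c1 : ∀ a, a * e1 ^ n = e1 ^ n * a)
    (c2 : ∀ a, a * e2 ^ n = e2 ^ n * a)
    [Module (MvPolynomial (Fin 3) K) A] [IsScalarTower K (MvPolynomial (Fin 3) K) A]
    (hX : ∀ (d : Fin 3 →₀ ℕ) (a : A), (MvPolynomial.monomial d (1 : K)) • a =
      (e0 ^ n) ^ (d 0) * (e1 ^ n) ^ (d 1) * (e2 ^ n) ^ (d 2) * a) :
    Module.Free (MvPolynomial (Fin 3) K) A ∧ Module.Finite (MvPolynomial (Fin 3) K) A := by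
  let Ψ : ((Fin n × Fin n × Fin n) →₀ MvPolynomial (Fin 3) K) →ₗ[MvPolynomial (Fin 3) K] A :=
    Finsupp.linearCombination _ (fun p => e0 ^ (p.1 : ℕ) * e1 ^ (p.2.1 : ℕ) * e2 ^ (p.2.2 : ℕ))
  let b1 := Finsupp.basis (fun _ : Fin n × Fin n × Fin n => MvPolynomial.basisMonomials (Fin 3) K)
  let E := b1.equiv b (jkIdx n)
  have hΨ : Ψ.restrictScalars K = E.toLinearMap := by
    apply b1.ext
    rintro ⟨⟨i, j, k⟩, d⟩
    rw [LinearEquiv.coe_coe, Module.Basis.equiv_apply]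
    change Ψ (b1 ⟨(i, j, k), d⟩) = b (n * d 0 + i, n * d 1 + j, n * d 2 + k)
    rw [hb]
    simp only [b1, Finsupp.coe_basis, MvPolynomial.coe_basisMonomials, Ψ,
      Finsupp.linearCombination_single]
    rw [hX]
    have p1 : ∀ (l : ℕ) a, (e1 ^ n) ^ l * a = a * (e1 ^ n) ^ l := fun l a =>
      ((show Commute (e1 ^ n) a from (c1 a).symm).pow_left l).eq
    have p2 : ∀ (l : ℕ) a, (e2 ^ n) ^ l * a = a * (e2 ^ n) ^ l := fun l a =>
      ((show Commute (e2 ^ n) a from (c2 a).symm).pow_left l).eq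
    rw [pow_add, pow_add, pow_add, pow_mul, pow_mul, pow_mul]
    calc _ = (e0 ^ n) ^ d 0 * ((e1 ^ n) ^ d 1 * ((e2 ^ n) ^ d 2 * (e0 ^ (i:ℕ) * e1 ^ (j:ℕ)))) *
          e2 ^ (k : ℕ) := by simp only [mul_assoc]
      _ = (e0 ^ n) ^ d 0 * ((e1 ^ n) ^ d 1 * e0 ^ (i:ℕ)) * e1 ^ (j:ℕ) * (e2 ^ n) ^ d 2 *
          e2 ^ (k : ℕ) := by rw [p2]; simp only [mul_assoc]
      _ = _ := by rw [p1]; simp only [mul_assoc]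
  have hbij : Function.Bijective Ψ := by
    have : (Ψ : _ → A) = E := by
      funext v
      exact DFunLike.congr_fun hΨ v
    rw [this]
    exact E.bijective
  let Ψ' := LinearEquiv.ofBijective Ψ hbij
  exact ⟨Module.Free.of_equiv Ψ', Module.Finite.equiv Ψ'⟩

theorem JKPBW.cm [CharZero K] (hb : JKPBW b e0 e1 e2) (h : JKRel q x e0 e1 e2) {n : ℕ}
    (hn : 2 ≤ n) (hq : IsPrimitiveRoot q n) (m : Ideal (Subalgebra.center K A))
    [hm : m.IsMaximal] (Rm : Type*) [CommRing Rm] [Algebra (Subalgebra.center K A) Rm]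
    [IsLocalization.AtPrime Rm m] : IsCohenMacaulayLocal Rm := by
  have : NeZero n := ⟨by omega⟩
  obtain ⟨hY0, hY2, hX1, hX2⟩ := h.pow_central hn hq
  obtain ⟨hZ0, hZ1⟩ := h.pow_central' hn hq
  have mX := hb.central (Commute.self_pow e0 n) hX1 hX2
  have mY := hb.central hY0 (Commute.self_pow e1 n) hY2
  have mZ := hb.central hZ0 hZ1 (Commute.self_pow e2 n)
  let φ : MvPolynomial (Fin 3) K →ₐ[K] Subalgebra.center K A :=
    MvPolynomial.aeval ![⟨_, mX⟩, ⟨_, mY⟩, ⟨_, mZ⟩]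
  letI : Algebra (MvPolynomial (Fin 3) K) (Subalgebra.center K A) := φ.toAlgebra
  letI : Module (MvPolynomial (Fin 3) K) A := Module.compHom A φ.toRingHom
  haveI t1 : IsScalarTower K (MvPolynomial (Fin 3) K) (Subalgebra.center K A) :=
    IsScalarTower.of_algebraMap_eq' φ.comp_algebraMap.symm
  have hsm : ∀ (p : MvPolynomial (Fin 3) K) (a : A), p • a = (φ p : A) * a := fun p a => rfl
  haveI t2 : IsScalarTower K (MvPolynomial (Fin 3) K) A := ⟨fun c p a => by
    rw [hsm, hsm, map_smul, SetLike.val_smul, smul_mul_assoc]⟩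
  haveI t3 : IsScalarTower (MvPolynomial (Fin 3) K) (Subalgebra.center K A) A := ⟨fun p z a => by
    rw [hsm]
    change (φ p * z : A) * a = φ p * (z * a)
    rw [mul_assoc]⟩
  obtain ⟨hfree, hfin⟩ := hb.free (n := n) (Subalgebra.mem_center_iff.mp mX)
    (Subalgebra.mem_center_iff.mp mY) (Subalgebra.mem_center_iff.mp mZ) (by
      intro d a
      rw [hsm]
      congr 1
      simp [φ, MvPolynomial.aeval_monomial, Finsupp.prod_fintype, Fin.prod_univ_three])
  obtain ⟨ρ, hρ⟩ := hb.retract h hn hq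
  let i : Subalgebra.center K A →ₗ[MvPolynomial (Fin 3) K] A :=
    { toFun := fun z => z
      map_add' := fun _ _ => rfl
      map_smul' := fun _ _ => rfl }
  let ρ' : A →ₗ[MvPolynomial (Fin 3) K] Subalgebra.center K A :=
    ρ.restrictScalars (MvPolynomial (Fin 3) K)
  have hri : ρ' ∘ₗ i = LinearMap.id := LinearMap.ext fun z => hρ z
  haveI : Module.Flat (MvPolynomial (Fin 3) K) (Subalgebra.center K A) :=
    Module.Flat.of_retract i ρ' hri
  haveI : Module.Finite (MvPolynomial (Fin 3) K) (Subalgebra.center K A) :=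
    Module.Finite.of_surjective ρ' (fun z => ⟨z, hρ z⟩)
  have hd : ringKrullDim (MvPolynomial (Fin 3) K) = 3 := by
    rw [MvPolynomial.ringKrullDim_of_isNoetherianRing]
    simp
  exact jk_CM hd (MvPolynomial.X 0) (MvPolynomial.X 1) (MvPolynomial.X 2)
    (fun f0 f1 f2 h0 h1 h2 => jk_weaklyRegular_three f0 f1 f2 h0 h1 h2) m Rm

end JKMain

section JKBaseChange

variable {K : Type*} [Field K] {A : Type*} [Ring A] [Algebra K A] {q x : K} {e0 e1 e2 : A}

lemma JKRel.baseChange (L : Type*) [Field L] [Algebra K L] (h : JKRel q x e0 e1 e2) :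
    JKRel (algebraMap K L q) (algebraMap K L x) ((1 : L) ⊗ₜ[K] e0) ((1 : L) ⊗ₜ[K] e1)
      ((1 : L) ⊗ₜ[K] e2) := by
  have hs : ∀ (c : K) (a : A), algebraMap K L c • ((1 : L) ⊗ₜ[K] a) = (1 : L) ⊗ₜ[K] (c • a) := by
    intro c a
    rw [algebraMap_smul, TensorProduct.tmul_smul]
  constructor
  · rw [Algebra.TensorProduct.tmul_mul_tmul, Algebra.TensorProduct.tmul_mul_tmul, mul_one, hs,
      h.h01]
  · rw [Algebra.TensorProduct.tmul_mul_tmul, Algebra.TensorProduct.tmul_mul_tmul, mul_one, hs,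
      h.h20]
  · have e : algebraMap K L x * (1 - algebraMap K L q ^ 2) = algebraMap K L (x * (1 - q ^ 2)) := by
      simp
    rw [e, ← map_pow, Algebra.TensorProduct.one_def, Algebra.TensorProduct.tmul_mul_tmul,
      Algebra.TensorProduct.tmul_mul_tmul, mul_one, hs, hs, hs, h.h21, TensorProduct.tmul_add,
      TensorProduct.tmul_add]

lemma JKPBW.baseChange (L : Type*) [Field L] [Algebra K L] {b : Module.Basis (ℕ × ℕ × ℕ) K A}
    (hb : JKPBW b e0 e1 e2) : JKPBW (Algebra.TensorProduct.basis L b) ((1 : L) ⊗ₜ[K] e0)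
      ((1 : L) ⊗ₜ[K] e1) ((1 : L) ⊗ₜ[K] e2) := by
  intro i j k
  rw [Algebra.TensorProduct.basis_apply, hb]
  simp [Algebra.TensorProduct.tmul_pow, Algebra.TensorProduct.tmul_mul_tmul]

end JKBaseChange

set_option synthInstance.maxHeartbeats 1000000
set_option maxHeartbeats 1000000

/-- Let `K` be a field of characteristic zero containing a primitive
`n`-th root of unity `ζ` (`n ≥ 2`), `r` an integer such that `ζ^r` is again a
primitive `n`-th root of unity, and `x ∈ K`.  Then the centre of the Jackson algebra
`𝒥_x(r)` over `K` is a Cohen–Macaulay ring (its localization at every maximal ideal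
is a Cohen–Macaulay local ring), and the same holds for the centre of the base change
`𝒥_x(r) ⊗_K K^alg` to an algebraic closure of `K`. -/
theorem jackson_centre_cohenMacaulay (K : Type*) [Field K] [CharZero K]
    (n : ℕ) (hn : 2 ≤ n) (ζ : K) (hζ : IsPrimitiveRoot ζ n)
    (r : ℤ) (hr : IsPrimitiveRoot (ζ ^ r) n) (x : K) :
    (∀ (m : Ideal (Subalgebra.center K (Jackson K ζ r x))) (hm : m.IsMaximal)
      (Rm : Type*) (_ : CommRing Rm)
      (_ : Algebra (Subalgebra.center K (Jackson K ζ r x)) Rm),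
      letI := hm.isPrime
      IsLocalization.AtPrime Rm m → IsCohenMacaulayLocal Rm) ∧
    (∀ (m : Ideal (Subalgebra.center (AlgebraicClosure K)
          (AlgebraicClosure K ⊗[K] Jackson K ζ r x))) (hm : m.IsMaximal)
      (Rm : Type*) (_ : CommRing Rm)
      (_ : Algebra (Subalgebra.center (AlgebraicClosure K)
            (AlgebraicClosure K ⊗[K] Jackson K ζ r x)) Rm),
      letI := hm.isPrime
      IsLocalization.AtPrime Rm m → IsCohenMacaulayLocal Rm) := by

  obtain ⟨b, hb⟩ := jackson_pbw ζ r x (hr.ne_zero (by omega))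
  have hR := jkGen_rel ζ r x
  have : CharZero (AlgebraicClosure K) :=
    charZero_of_injective_algebraMap (algebraMap K (AlgebraicClosure K)).injective
  refine ⟨?_, ?_⟩
  · intro m hm Rm _ _ hloc
    exact hb.cm hR hn hr m Rm
  · intro m hm Rm _ _ hloc
    exact (hb.baseChange (AlgebraicClosure K)).cm (hR.baseChange (AlgebraicClosure K)) hn
      (hr.map_of_injective (algebraMap K (AlgebraicClosure K)).injective) m Rm
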